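/- arXiv:0909.1817 — 3 statements merged into one kernel-verified Lean document; each statement's English description precedes it below -/
import Mathlib

section
/- (Optimal private-power split; core of the R_c threshold theorem.) Assume P₁ > 0, P₂ > 0, h₁ ≠ 0, h₂ ≠ 0, and let D = det(H†H) ≥ 0. Fix t ∈ (0, 1]. Let A₁ = P₁‖h₁‖² + P₁P₂D, A₂ = P₂‖h₂‖² + P₁P₂D, and k = √(A₂/A₁). For α > 0 define g(α) = 1 + (1−α)P₁‖h₁‖² + (1 − t²/α)P₂‖h₂‖² + (1 − α + t² − t²/α)·P₁P₂D. Then for every α > 0, g(α) ≤ g(t·k), and g(t·k) = det(I_N + H · diag((1−k t)P₁, (1−k⁻¹ t)P₂) · H†) = 1 + (1−kt)P₁‖h₁‖² + (1−k⁻¹t)P₂‖h₂‖² + (1−kt)(1−k⁻¹t)P₁P₂D. -/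
open Matrix Complex Filter

/-- The `N × 2` matrix with columns `h₁` and `h₂`. -/
noncomputable def Hm {N : ℕ} (h₁ h₂ : Fin N → ℂ) : Matrix (Fin N) (Fin 2) ℂ :=
  Matrix.of fun i j => if j = 0 then h₁ i else h₂ i

/-- The Hermitian inner product `h₁† h₂ = ∑ i, conj (h₁ i) * h₂ i`. -/
noncomputable def ip {N : ℕ} (h₁ h₂ : Fin N → ℂ) : ℂ :=
  ∑ i, (starRingEnd ℂ) (h₁ i) * h₂ i

/-- The squared Euclidean norm `‖h‖²`. -/
noncomputable def nsq {N : ℕ} (h : Fin N → ℂ) : ℝ :=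
  ∑ i, Complex.normSq (h i)

/-- `det (H† H)`, a nonnegative real number (taken via the real part). -/
noncomputable def detHH {N : ℕ} (h₁ h₂ : Fin N → ℂ) : ℝ :=
  (((Hm h₁ h₂)ᴴ * Hm h₁ h₂).det).re

/-- The relay covariance matrix `Q_r(ρ)` with diagonal `P₁, P₂` and
off-diagonal `ρ √(P₁ P₂)`. -/
noncomputable def Qr (P₁ P₂ : ℝ) (ρ : ℂ) : Matrix (Fin 2) (Fin 2) ℂ :=
  !![(P₁ : ℂ), ρ * (Real.sqrt (P₁ * P₂) : ℂ);
     (starRingEnd ℂ) ρ * (Real.sqrt (P₁ * P₂) : ℂ), (P₂ : ℂ)]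

/-- `det (I_N + H Q_r(ρ) H†)` (a real number, taken via the real part). -/
noncomputable def MACdet {N : ℕ} (h₁ h₂ : Fin N → ℂ) (P₁ P₂ : ℝ) (ρ : ℂ) : ℝ :=
  ((1 + Hm h₁ h₂ * Qr P₁ P₂ ρ * (Hm h₁ h₂)ᴴ).det).re

theorem nsq_pos_aux {N : ℕ} (h : Fin N → ℂ) (hh : h ≠ 0) : 0 < nsq h := by
  obtain ⟨i, hi⟩ := Function.ne_iff.mp hh
  exact Finset.sum_pos' (fun i _ => Complex.normSq_nonneg _)
    ⟨i, Finset.mem_univ _, Complex.normSq_pos.mpr hi⟩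

open scoped ComplexOrder in
theorem detHH_nonneg_aux {N : ℕ} (h₁ h₂ : Fin N → ℂ) : 0 ≤ detHH h₁ h₂ := by
  have h := (Matrix.posSemidef_conjTranspose_mul_self (Hm h₁ h₂)).det_nonneg
  exact (Complex.le_def.mp h).1

theorem det_aux {N : ℕ} (h₁ h₂ : Fin N → ℂ) (a b : ℝ) :
    ((1 + Hm h₁ h₂ * Matrix.diagonal ![(a : ℂ), (b : ℂ)] * (Hm h₁ h₂)ᴴ).det).re
      = 1 + a * nsq h₁ + b * nsq h₂ + a * b * detHH h₁ h₂ := by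
  have e0 : ((Hm h₁ h₂)ᴴ * Hm h₁ h₂) 0 0 = (nsq h₁ : ℂ) := by
    simp [Matrix.mul_apply, Hm, nsq, Complex.normSq_eq_conj_mul_self]
  have e1 : ((Hm h₁ h₂)ᴴ * Hm h₁ h₂) 1 1 = (nsq h₂ : ℂ) := by
    simp [Matrix.mul_apply, Hm, nsq, Complex.normSq_eq_conj_mul_self]
  rw [Matrix.mul_assoc, Matrix.det_one_add_mul_comm, Matrix.mul_assoc]
  unfold detHH
  generalize (Hm h₁ h₂)ᴴ * Hm h₁ h₂ = G at *
  have : (1 + Matrix.diagonal ![(a : ℂ), (b : ℂ)] * G).det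
      = ((1 + a * nsq h₁ + b * nsq h₂ : ℝ) : ℂ) + ((a * b : ℝ) : ℂ) * G.det := by
    rw [Matrix.det_fin_two, Matrix.det_fin_two]
    simp [Matrix.diagonal_mul, e0, e1]
    ring
  rw [this, Complex.add_re, Complex.re_ofReal_mul, Complex.ofReal_re]

/-- Optimal private-power split. With `D = det(H†H)`,
`A₁ = P₁‖h₁‖² + P₁P₂D`, `A₂ = P₂‖h₂‖² + P₁P₂D`, `k = √(A₂/A₁)` and, for `α > 0`,
`g(α) = 1 + (1−α)P₁‖h₁‖² + (1 − t²/α)P₂‖h₂‖² + (1 − α + t² − t²/α)P₁P₂D`, the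
function `g` is maximized over `α > 0` at `α = t·k`, and
`g(t·k) = det(I_N + H diag((1−kt)P₁, (1−k⁻¹t)P₂) H†)
        = 1 + (1−kt)P₁‖h₁‖² + (1−k⁻¹t)P₂‖h₂‖² + (1−kt)(1−k⁻¹t)P₁P₂D`. -/
theorem stmt11 {N : ℕ} (hN : 0 < N) (h₁ h₂ : Fin N → ℂ) (P₁ P₂ t : ℝ)
    (hP₁ : 0 < P₁) (hP₂ : 0 < P₂) (hh₁ : h₁ ≠ 0) (hh₂ : h₂ ≠ 0)
    (ht : t ∈ Set.Ioc (0 : ℝ) 1) :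
    let D : ℝ := detHH h₁ h₂
    let A₁ : ℝ := P₁ * nsq h₁ + P₁ * P₂ * D
    let A₂ : ℝ := P₂ * nsq h₂ + P₁ * P₂ * D
    let k : ℝ := Real.sqrt (A₂ / A₁)
    let g : ℝ → ℝ := fun α =>
      1 + (1 - α) * (P₁ * nsq h₁) + (1 - t ^ 2 / α) * (P₂ * nsq h₂)
        + (1 - α + t ^ 2 - t ^ 2 / α) * (P₁ * P₂ * D)
    (∀ α : ℝ, 0 < α → g α ≤ g (t * k)) ∧
    g (t * k) =
      ((1 + Hm h₁ h₂ *
          Matrix.diagonal ![(((1 - k * t) * P₁ : ℝ) : ℂ), (((1 - k⁻¹ * t) * P₂ : ℝ) : ℂ)] *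
          (Hm h₁ h₂)ᴴ).det).re ∧
    g (t * k) =
      1 + (1 - k * t) * (P₁ * nsq h₁) + (1 - k⁻¹ * t) * (P₂ * nsq h₂)
        + (1 - k * t) * (1 - k⁻¹ * t) * (P₁ * P₂ * D) := by
  intro D A₁ A₂ k g
  have hD : 0 ≤ D := detHH_nonneg_aux h₁ h₂
  have hn1 := nsq_pos_aux h₁ hh₁
  have hn2 := nsq_pos_aux h₂ hh₂
  have hA1 : 0 < A₁ := by positivity
  have hA2 : 0 < A₂ := by positivity
  have hk : 0 < k := Real.sqrt_pos.mpr (div_pos hA2 hA1)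
  have hk2 : k ^ 2 * A₁ = A₂ := by
    rw [Real.sq_sqrt (div_pos hA2 hA1).le]
    field_simp
  have ht0 : 0 < t := ht.1
  have hg : ∀ α, g α = 1 + P₁ * nsq h₁ + P₂ * nsq h₂ + (1 + t ^ 2) * (P₁ * P₂ * D)
      - α * A₁ - t ^ 2 / α * A₂ := by
    intro α
    simp only [g, A₁, A₂]
    ring
  have h3 : g (t * k) =
      1 + (1 - k * t) * (P₁ * nsq h₁) + (1 - k⁻¹ * t) * (P₂ * nsq h₂)
        + (1 - k * t) * (1 - k⁻¹ * t) * (P₁ * P₂ * D) := by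
    simp only [g]
    clear_value k
    field_simp
    ring
  refine ⟨?_, ?_, h3⟩
  · intro α hα
    have : g (t * k) - g α = A₁ * (α - t * k) ^ 2 / α := by
      rw [hg, hg, ← hk2]
      clear_value k
      field_simp
      ring
    have h0 : 0 ≤ A₁ * (α - t * k) ^ 2 / α := by positivity
    linarith
  · rw [det_aux, h3]
    ring
end

section
/- (Amplify-and-forward determinant identity.) Let M, N be positive integers, G a 2×M complex matrix, Q an M×M positive semidefinite Hermitian matrix, H an N×2 complex matrix, and A a 2×2 complex matrix. Then I_N + H A A† H† and I₂ + A† H† H A are invertible, and det( I_N + H A G Q G† A† H† · (I_N + H A A† H†)^{-1} ) = det( I_M + G Q G† A† H† (I_N + H A A† H†)^{-1} H A ) = det( I_M + G Q G† · ( I₂ − (I₂ + A† H† H A)^{-1} ) ) — where in the middle expression the 2×2/ M×M products are formed in the indicated order (equality of the three determinants). -/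
open Matrix Complex
open scoped ComplexOrder

theorem aux_unit {m n : ℕ} (B : Matrix (Fin m) (Fin n) ℂ) : IsUnit (1 + B * Bᴴ) :=
  (Matrix.PosDef.one.add_posSemidef (Matrix.posSemidef_self_mul_conjTranspose B)).isUnit

theorem aux_push {m n : ℕ} (B : Matrix (Fin m) (Fin n) ℂ) :
    Bᴴ * (1 + B * Bᴴ)⁻¹ * B = 1 - (1 + Bᴴ * B)⁻¹ := by
  have h1 := aux_unit B
  have h2 : IsUnit (1 + Bᴴ * B) := by simpa using aux_unit Bᴴ
  have e1 := Matrix.mul_nonsing_inv _ ((Matrix.isUnit_iff_isUnit_det _).1 h1)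
  have e2 := Matrix.mul_nonsing_inv _ ((Matrix.isUnit_iff_isUnit_det _).1 h2)
  apply h2.mul_left_cancel
  have e3 : (1 + Bᴴ * B) * Bᴴ = Bᴴ * (1 + B * Bᴴ) := by
    rw [Matrix.add_mul, Matrix.mul_add, Matrix.one_mul, Matrix.mul_one, Matrix.mul_assoc]
  rw [Matrix.mul_sub, e2, ← Matrix.mul_assoc, ← Matrix.mul_assoc, e3, Matrix.mul_assoc Bᴴ, e1]
  simp

/-- Amplify-and-forward determinant identity. For a `2×M` matrix `G`,
an `M×M` positive semidefinite Hermitian `Q`, an `N×2` matrix `H` and a `2×2` matrix `A`: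
`I_N + H A A† H†` and `I₂ + A† H† H A` are invertible, and
`det(I_N + H A G Q G† A† H† (I_N + H A A† H†)⁻¹)
 = det(I₂ + G Q G† A† H† (I_N + H A A† H†)⁻¹ H A)
 = det(I₂ + G Q G† (I₂ − (I₂ + A† H† H A)⁻¹))`. -/
theorem stmt12 {M N : ℕ} (hM : 0 < M) (hN : 0 < N)
    (G : Matrix (Fin 2) (Fin M) ℂ) (Q : Matrix (Fin M) (Fin M) ℂ) (hQ : Q.PosSemidef)
    (H : Matrix (Fin N) (Fin 2) ℂ) (A : Matrix (Fin 2) (Fin 2) ℂ) :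
    IsUnit (1 + H * A * Aᴴ * Hᴴ) ∧ IsUnit (1 + Aᴴ * Hᴴ * H * A) ∧
    (1 + H * A * G * Q * Gᴴ * Aᴴ * Hᴴ * (1 + H * A * Aᴴ * Hᴴ)⁻¹).det =
      (1 + G * Q * Gᴴ * Aᴴ * Hᴴ * (1 + H * A * Aᴴ * Hᴴ)⁻¹ * H * A).det ∧
    (1 + G * Q * Gᴴ * Aᴴ * Hᴴ * (1 + H * A * Aᴴ * Hᴴ)⁻¹ * H * A).det =
      (1 + G * Q * Gᴴ * (1 - (1 + Aᴴ * Hᴴ * H * A)⁻¹)).det := by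
  have hB : (H * A)ᴴ = Aᴴ * Hᴴ := Matrix.conjTranspose_mul _ _
  have r1 : H * A * Aᴴ * Hᴴ = (H * A) * (H * A)ᴴ := by rw [hB]; simp only [Matrix.mul_assoc]
  have r2 : Aᴴ * Hᴴ * H * A = (H * A)ᴴ * (H * A) := by rw [hB]; simp only [Matrix.mul_assoc]
  rw [r1, r2]
  refine ⟨aux_unit _, by simpa using aux_unit (H * A)ᴴ, ?_, ?_⟩
  · have := Matrix.det_one_add_mul_comm (H * A)
      (G * Q * Gᴴ * Aᴴ * Hᴴ * (1 + (H * A) * (H * A)ᴴ)⁻¹)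
    simpa only [Matrix.mul_assoc] using this
  · rw [← aux_push, hB]
    simp only [Matrix.mul_assoc]
end

section
/- (Vanishing of the residual interference matrix.) Let h₁, h₂ ∈ ℂ^N, H = [h₁ h₂], and assume det(H†H) > 0. For a, b, φ ∈ ℝ let A(a,b,φ) = diag(a·e^{iφ}, b). Then every entry of (I₂ + A(a,b,φ)† H† H A(a,b,φ))^{-1} tends to 0 as a → ∞ and b → ∞, uniformly in φ; formally, for any sequences aₙ → ∞, bₙ → ∞ of reals and any sequence φₙ of reals, the matrices (I₂ + A(aₙ,bₙ,φₙ)† H† H A(aₙ,bₙ,φₙ))^{-1} converge entrywise to the zero matrix. -/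
open Matrix Complex Filter

/-- Vanishing of the residual interference matrix. If `det(H†H) > 0`,
then for any real sequences `aₙ → ∞`, `bₙ → ∞` and any real sequence `φₙ`, the matrices
`(I₂ + A(aₙ,bₙ,φₙ)† H† H A(aₙ,bₙ,φₙ))⁻¹`, with `A(a,b,φ) = diag(a e^{iφ}, b)`,
converge entrywise to the zero matrix. -/
theorem stmt14 {N : ℕ} (hN : 0 < N) (h₁ h₂ : Fin N → ℂ)
    (hD : 0 < detHH h₁ h₂) (a b φ : ℕ → ℝ)
    (ha : Filter.Tendsto a Filter.atTop Filter.atTop)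
    (hb : Filter.Tendsto b Filter.atTop Filter.atTop) :
    Filter.Tendsto
      (fun n =>
        (1 + (Matrix.diagonal
                ![(a n : ℂ) * Complex.exp (Complex.I * (φ n : ℂ)), (b n : ℂ)])ᴴ *
              (Hm h₁ h₂)ᴴ * Hm h₁ h₂ *
              Matrix.diagonal
                ![(a n : ℂ) * Complex.exp (Complex.I * (φ n : ℂ)), (b n : ℂ)])⁻¹)
      Filter.atTop (nhds (0 : Matrix (Fin 2) (Fin 2) ℂ)) := by
  set G : Matrix (Fin 2) (Fin 2) ℂ := (Hm h₁ h₂)ᴴ * Hm h₁ h₂ with hG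
  have hdet : G.det ≠ 0 := by
    intro h
    have : detHH h₁ h₂ = 0 := by
      unfold detHH
      rw [← hG, h]
      simp
    exact hD.ne' this
  set d : ℕ → Fin 2 → ℂ := fun n =>
    ![(a n : ℂ) * Complex.exp (Complex.I * (φ n : ℂ)), (b n : ℂ)] with hd
  set D : ℕ → Matrix (Fin 2) (Fin 2) ℂ := fun n => Matrix.diagonal (fun i => (d n i)⁻¹) with hDd
  have hd0 : ∀ i, Tendsto (fun n => (d n i)⁻¹) atTop (nhds 0) := by
    intro i
    rw [tendsto_zero_iff_norm_tendsto_zero]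
    have hn : Tendsto (fun n => ‖d n i‖) atTop atTop := by
      fin_cases i
      · have : (fun n => ‖d n 0‖) = fun n => |a n| := by
          funext n
          simp [hd, mul_comm Complex.I]
        simpa only [Fin.zero_eta, this, Function.comp_def] using tendsto_abs_atTop_atTop.comp ha
      · have : (fun n => ‖d n 1‖) = fun n => |b n| := by
          funext n
          simp [hd]
        simpa only [Fin.mk_one, this, Function.comp_def] using tendsto_abs_atTop_atTop.comp hb
    simpa only [norm_inv, Function.comp_def] using tendsto_inv_atTop_zero.comp hn
  have hDt : Tendsto D atTop (nhds 0) := by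
    have hc : Continuous (fun v : Fin 2 → ℂ => Matrix.diagonal v) := by fun_prop
    have h1 : Tendsto (fun n => fun i => (d n i)⁻¹) atTop (nhds (0 : Fin 2 → ℂ)) :=
      tendsto_pi_nhds.2 hd0
    have h2 := (hc.tendsto 0).comp h1
    have h3 : Matrix.diagonal (0 : Fin 2 → ℂ) = 0 := Matrix.diagonal_zero
    rw [h3] at h2
    exact h2
  have hDs : Tendsto (fun n => (D n)ᴴ) atTop (nhds 0) := by
    have hc : Continuous (fun v : Matrix (Fin 2) (Fin 2) ℂ => vᴴ) := by fun_prop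
    have h2 := (hc.tendsto 0).comp hDt
    rw [Matrix.conjTranspose_zero] at h2
    exact h2
  have hM : Tendsto (fun n => (D n)ᴴ * D n + G) atTop (nhds G) := by
    have h := (hDs.mul hDt).add_const G
    simpa using h
  have hMi : Tendsto (fun n => ((D n)ᴴ * D n + G)⁻¹) atTop (nhds G⁻¹) := by
    have hc1 : Continuous (fun v : Matrix (Fin 2) (Fin 2) ℂ => v.det) := by fun_prop
    have hc2 : Continuous (fun v : Matrix (Fin 2) (Fin 2) ℂ => v.adjugate) :=
      continuous_id.matrix_adjugate
    have h1 := ((hc1.tendsto G).comp hM).inv₀ hdet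
    have h2 := (hc2.tendsto G).comp hM
    simp only [Matrix.inv_def, Ring.inverse_eq_inv']
    exact h1.smul h2
  have hP := (hDt.mul hMi).mul hDs
  simp only [zero_mul] at hP
  refine hP.congr' ?_
  filter_upwards [ha.eventually_gt_atTop 0, hb.eventually_gt_atTop 0] with n hna hnb
  have hne : ∀ i, d n i ≠ 0 := by
    intro i
    fin_cases i
    · simp [hd, hna.ne']
    · simp [hd, hnb.ne']
  have hAD : Matrix.diagonal (d n) * D n = 1 := by
    simp only [hDd, Matrix.diagonal_mul_diagonal]
    simp [hne]
  have hDA : D n * Matrix.diagonal (d n) = 1 := mul_eq_one_comm.1 hAD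
  have hDA' : (Matrix.diagonal (d n))ᴴ * (D n)ᴴ = 1 := by
    rw [← Matrix.conjTranspose_mul, hDA, Matrix.conjTranspose_one]
  have e : 1 + (Matrix.diagonal (d n))ᴴ * (Hm h₁ h₂)ᴴ * Hm h₁ h₂ * Matrix.diagonal (d n)
      = (Matrix.diagonal (d n))ᴴ * (((D n)ᴴ * D n + G) * Matrix.diagonal (d n)) := by
    rw [add_mul, mul_add, mul_assoc (D n)ᴴ, hDA, mul_one, hDA', hG]
    simp only [Matrix.mul_assoc]
  have hi1 : (Matrix.diagonal (d n))⁻¹ = D n := Matrix.inv_eq_right_inv hAD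
  have hi2 : ((Matrix.diagonal (d n))ᴴ)⁻¹ = (D n)ᴴ := Matrix.inv_eq_right_inv hDA'
  change _ = (1 + (Matrix.diagonal (d n))ᴴ * (Hm h₁ h₂)ᴴ * Hm h₁ h₂ * Matrix.diagonal (d n))⁻¹
  rw [e, Matrix.mul_inv_rev, Matrix.mul_inv_rev, hi1, hi2]
end
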